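/- Let a = (w_1, …, w_n) be a CLT sentence (a weak CLT sentence with wt(a) = 1 + Σ_{i=1}^n (ℓ(w_i) − 2)/2) whose words w_i contain no self-edge (E_{w_i}^s = ∅ for all i). Then for each index i there exists a UNIQUE index j ≠ i such that E_{w_i} ∩ E_{w_j} ≠ ∅. -/

import Mathlib

/-- The list of edges (unordered pairs of adjacent letters) traversed by the word `w`. -/
def edgeList (w : List ℕ) : List (Sym2 ℕ) :=
  (w.zip w.tail).map fun p => s(p.1, p.2)

/-- The edge set `E_w` of the graph `G_w` of the word `w`. -/
def edgeFinset (w : List ℕ) : Finset (Sym2 ℕ) := (edgeList w).toFinset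

/-- The traversal count `N_e^w`: the number of times the walk `w` traverses the edge `e`
(in either direction). -/
def trav (w : List ℕ) (e : Sym2 ℕ) : ℕ := (edgeList w).count e

/-- The support of a word: the set of letters appearing in it. -/
def wsupp (w : List ℕ) : Finset ℕ := w.toFinset

/-- A word is a closed word starting at the letter `1`: a finite sequence of positive
integers whose first and last letters are both equal to `1`. -/
def IsClosedWordAtOne (w : List ℕ) : Prop :=
  w ≠ [] ∧ w.head? = some 1 ∧ w.getLast? = some 1 ∧ ∀ x ∈ w, 0 < x

/-- `(w₁, w₂)` is a weak CLT pair: both are closed words starting at `1`, every edge of the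
combined graph is traversed at least twice in total, and the two words share an edge. -/
def IsWeakCLTPair (w₁ w₂ : List ℕ) : Prop :=
  IsClosedWordAtOne w₁ ∧ IsClosedWordAtOne w₂ ∧
    (∀ e ∈ edgeFinset w₁ ∪ edgeFinset w₂, 2 ≤ trav w₁ e + trav w₂ e) ∧
    (edgeFinset w₁ ∩ edgeFinset w₂).Nonempty


/-- The list of all edge-traversals of the sentence `a = (w₁, …, wₙ)`. -/
def sentEdgeList (a : List (List ℕ)) : List (Sym2 ℕ) := (a.map edgeList).flatten

/-- The edge set `E_a` of the graph `G_a` of the sentence `a`. -/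
def sentEdgeFinset (a : List (List ℕ)) : Finset (Sym2 ℕ) := (sentEdgeList a).toFinset

/-- The total traversal count `N_e^a` of the edge `e` by the walks of the sentence `a`. -/
def sentTrav (a : List (List ℕ)) (e : Sym2 ℕ) : ℕ := (sentEdgeList a).count e

/-- The support of a sentence: the union of the supports of its words. -/
def sentSupp (a : List (List ℕ)) : Finset ℕ := a.flatten.toFinset

/-- `a = (w₁, …, wₙ)` is a weak CLT sentence: it consists of at least one word, all its words
are closed words starting at `1`, every edge of `G_a` is traversed at least twice in total,
and every word shares an edge with some other word of the sentence. -/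
def IsWeakCLTSentence (a : List (List ℕ)) : Prop :=
  a ≠ [] ∧ (∀ w ∈ a, IsClosedWordAtOne w) ∧
    (∀ e ∈ sentEdgeFinset a, 2 ≤ sentTrav a e) ∧
    ∀ i : Fin a.length, ∃ j : Fin a.length, j ≠ i ∧
      (edgeFinset (a.get i) ∩ edgeFinset (a.get j)).Nonempty

/-- `a` is a CLT sentence: a weak CLT sentence with
`wt(a) = 1 + Σᵢ (ℓ(wᵢ) - 2)/2`. -/
def IsCLTSentence (a : List (List ℕ)) : Prop :=
  IsWeakCLTSentence a ∧
    ((sentSupp a).card : ℚ) = 1 + ∑ i : Fin a.length, (((a.get i).length : ℚ) - 2) / 2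

/-- The change of the `ZMod 2`-valued vertex labelling `χ` along an edge. -/
def coboundary {α : Type*} (χ : α → ZMod 2) : Sym2 α → ZMod 2 :=
  Sym2.lift ⟨fun u v => χ u + χ v, fun _ _ => add_comm _ _⟩

@[simp]
theorem coboundary_mk {α : Type*} (χ : α → ZMod 2) (u v : α) :
    coboundary χ s(u, v) = χ u + χ v := rfl

/-- A connected graph on `V` has a spanning tree `F`, together with, for each `e ∈ F`, the
vertex labelling given by the two sides of the tree after removal of `e`. -/
theorem exists_spanningTree_cuts {α : Type*} [DecidableEq α] (V : Finset α)
    (E : Finset (Sym2 α)) (r : α) (hr : r ∈ V)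
    (hE : ∀ S ⊂ V, r ∈ S → ∃ x ∈ S, ∃ y ∈ V, y ∉ S ∧ s(x, y) ∈ E) :
    ∃ F ⊆ E, ∃ χ : Sym2 α → α → ZMod 2, F.card + 1 = V.card ∧
      (∀ e ∈ F, ∀ e' ∈ F, coboundary (χ e) e' = if e' = e then 1 else 0) ∧
      ∀ u ∈ V, ∀ v ∈ V, u ≠ v → ∃ e ∈ F, χ e u ≠ χ e v := by
  have key : ∀ k, k + 1 ≤ V.card → ∃ S ⊆ V, r ∈ S ∧ S.card = k + 1 ∧
      ∃ F ⊆ E, ∃ χ : Sym2 α → α → ZMod 2, F.card + 1 = S.card ∧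
      (∀ e ∈ F, ∀ u ∈ e, u ∈ S) ∧
      (∀ e ∈ F, ∀ e' ∈ F, coboundary (χ e) e' = if e' = e then 1 else 0) ∧
      ∀ u ∈ S, ∀ v ∈ S, u ≠ v → ∃ e ∈ F, χ e u ≠ χ e v := by
    intro k
    induction k with
    | zero =>
      intro _
      refine ⟨{r}, by simpa using hr, by simp, by simp, ∅, by simp, fun _ _ => 0, by simp,
        by simp, by simp, ?_⟩
      simp only [Finset.mem_singleton]
      rintro u rfl v rfl h
      exact absurd rfl h
    | succ k ih =>
      intro hk
      obtain ⟨S, hSV, hrS, hSc, F, hFE, χ, hFc, hFS, hcut, hsep⟩ := ih (by omega)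
      have hss : S ⊂ V := by
        refine hSV.ssubset_of_ne ?_
        rintro rfl
        omega
      obtain ⟨x, hx, y, hyV, hyS, hxy⟩ := hE S hss hrS
      have hne : x ≠ y := fun h => hyS (h ▸ hx)
      have hnew : s(x, y) ∉ F := fun h => hyS (hFS _ h y (by simp))
      have hnewne : ∀ e ∈ F, e ≠ s(x, y) := fun e he h => hnew (h ▸ he)
      refine ⟨insert y S, Finset.insert_subset hyV hSV, Finset.mem_insert_of_mem hrS,
        by rw [Finset.card_insert_of_notMem hyS, hSc], insert s(x, y) F,
        Finset.insert_subset hxy hFE,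
        fun e => if e = s(x, y) then Pi.single y 1 else Function.update (χ e) y (χ e x),
        ?_, ?_, ?_, ?_⟩
      · rw [Finset.card_insert_of_notMem hyS, Finset.card_insert_of_notMem hnew, hFc]
      · intro e he u hu
        rcases Finset.mem_insert.1 he with rfl | he
        · rcases Sym2.mem_iff.1 hu with rfl | rfl <;> simp [hx]
        · exact Finset.mem_insert_of_mem (hFS e he u hu)
      · have hold : ∀ e' ∈ F, ∀ ψ φ : α → ZMod 2, (∀ u ∈ S, ψ u = φ u) →
            coboundary ψ e' = coboundary φ e' := by
          intro e' he' ψ φ h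
          have hS := hFS e' he'
          induction e' with
          | _ u v => simp [h u (hS u (by simp)), h v (hS v (by simp))]
        have hyu : ∀ u ∈ S, u ≠ y := fun u hu h => hyS (h ▸ hu)
        intro e he e' he'
        rcases Finset.mem_insert.1 he with rfl | he
        · rcases Finset.mem_insert.1 he' with rfl | he'
          · simp [hne]
          · beta_reduce
            rw [if_neg (hnewne e' he'), if_pos rfl, hold e' he' _ (fun _ => 0)]
            · induction e' with
              | _ u v => simp
            · intro u hu
              simp [hyu u hu]
        · beta_reduce
          rw [if_neg (hnewne e he)]
          rcases Finset.mem_insert.1 he' with rfl | he'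
          · rw [if_neg (hnewne e he).symm]
            simp [hne, CharTwo.add_self_eq_zero]
          · rw [hold e' he' _ (χ e), hcut e he e' he']
            intro u hu
            simp [hyu u hu]
      · have hyu : ∀ u ∈ S, u ≠ y := fun u hu h => hyS (h ▸ hu)
        intro u hu v hv huv
        rw [Finset.mem_insert] at hu hv
        rcases hu with rfl | hu <;> rcases hv with rfl | hv
        · exact absurd rfl huv
        · exact ⟨s(x, u), by simp, by simp [hyu v hv]⟩
        · exact ⟨s(x, v), by simp, by simp [hyu u hu]⟩
        · obtain ⟨e, he, h⟩ := hsep u hu v hv huv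
          refine ⟨e, Finset.mem_insert_of_mem he, ?_⟩
          simpa [hnewne e he, hyu u hu, hyu v hv] using h
  have hpos : 0 < V.card := Finset.card_pos.2 ⟨r, hr⟩
  obtain ⟨S, hSV, -, hSc, F, hFE, χ, hFc, -, hcut, hsep⟩ := key (V.card - 1) (by omega)
  obtain rfl : S = V := Finset.eq_of_subset_of_card_le hSV (by omega)
  exact ⟨F, hFE, χ, hFc, hcut, hsep⟩

/-- The combinatorial core: `t i e` is the number of traversals of the edge `e` by the `i`-th
closed walk, `F` is the edge set of a spanning tree, and `X e` is the indicator modulo 2 of the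
edges crossing the cut defined by the tree edge `e`. -/
theorem existsUnique_partner {ι ε : Type*} [Fintype ι] [DecidableEq ι] [DecidableEq ε]
    (E F : Finset ε) (hFE : F ⊆ E) (t : ι → ε → ℕ) (X : ε → ε → ZMod 2)
    (htwo : ∀ e ∈ E, 2 ≤ ∑ i, t i e)
    (hcount : 2 * F.card + Fintype.card ι = ∑ e ∈ E, ∑ i, t i e)
    (hshare : ∀ i, ∃ j ≠ i, ∃ e ∈ E, 0 < t i e ∧ 0 < t j e)
    (hX : ∀ e ∈ F, ∀ e' ∈ F, X e e' = if e' = e then 1 else 0)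
    (hclosed : ∀ i, ∀ e ∈ F, ∑ e' ∈ E, (t i e' : ZMod 2) * X e e' = 0)
    (hsep : ∀ f ∈ E, f ∉ F → ∃ e ∈ F, X e f ≠ 0) (i : ι) :
    ∃! j, j ≠ i ∧ ∃ e ∈ E, 0 < t i e ∧ 0 < t j e := by
  classical
  set d : ι → ℕ := fun i => ∑ f ∈ E \ F, t i f with hd
  set U : ε → Finset ι := fun e => {i | 0 < t i e} with hU
  set s : ε → Finset ι := fun e => {i | d i = 0 ∧ 0 < t i e ∧ ∃ j ≠ i, 0 < t j e} with hs
  set c : ι → Finset ε := fun i => {e ∈ F | 0 < t i e ∧ ∃ j ≠ i, 0 < t j e} with hc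
  have hpar : ∀ i, ∀ e ∈ F, (t i e : ZMod 2) + ∑ f ∈ E \ F, (t i f : ZMod 2) * X e f = 0 := by
    intro i e he
    rw [← hclosed i e he, ← Finset.sum_sdiff hFE, add_comm]
    congr 1
    rw [Finset.sum_congr rfl fun e' he' => by rw [hX e he e' he']]
    simp [he]
  have hd0 : ∀ i, d i = 0 → ∀ f ∈ E, f ∉ F → t i f = 0 := by
    intro i hi f hf hfF
    exact Finset.sum_eq_zero_iff.1 hi f (Finset.mem_sdiff.2 ⟨hf, hfF⟩)
  have heven : ∀ i, d i = 0 → ∀ e ∈ F, Even (t i e) := by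
    intro i hi e he
    have h := hpar i e he
    rw [Finset.sum_eq_zero, add_zero] at h
    · exact (ZMod.natCast_eq_zero_iff_even).1 h
    · intro f hf
      rw [Finset.mem_sdiff] at hf
      simp [hd0 i hi f hf.1 hf.2]
  have hsU : ∀ e, s e ⊆ U e := by
    intro e i hi
    simp only [hs, hU, Finset.mem_filter, Finset.mem_univ, true_and] at hi ⊢
    exact hi.2.1
  have hUs : ∀ e ∈ F, (U e).card + (s e).card ≤ ∑ i, t i e := by
    intro e he
    rw [hU, hs, Finset.card_filter, Finset.card_filter, ← Finset.sum_add_distrib]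
    refine Finset.sum_le_sum fun i _ => ?_
    by_cases h0 : d i = 0
    · obtain ⟨m, hm⟩ := heven i h0 e he
      split_ifs <;> omega
    · simp only [h0, false_and, if_false]
      split_ifs <;> omega
  have hNs : ∀ e ∈ F, 2 + (s e).card ≤ ∑ i, t i e := by
    intro e he
    rcases (s e).eq_empty_or_nonempty with h | ⟨i, hi⟩
    · rw [h]; simpa using htwo e (hFE he)
    · have h2 : 2 ≤ (U e).card := by
        simp only [hs, Finset.mem_filter, Finset.mem_univ, true_and] at hi
        obtain ⟨-, hie, j, hji, hj⟩ := hi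
        exact Finset.one_lt_card.2 ⟨i, by simp [hU, hie], j, by simp [hU, hj], hji.symm⟩
      have := hUs e he
      omega
  have hdc : ∀ i, 1 ≤ d i + if d i = 0 then (c i).card else 0 := by
    intro i
    split_ifs with h0
    · obtain ⟨j, hji, e, he, hie, hje⟩ := hshare i
      have heF : e ∈ F := by
        by_contra hF
        have := hd0 i h0 e he hF
        omega
      have : 0 < (c i).card := Finset.card_pos.2 ⟨e, by simp [hc, heF, hie]; exact ⟨j, hji, hje⟩⟩
      omega
    · omega
  have hsc : ∑ e ∈ F, (s e).card = ∑ i, if d i = 0 then (c i).card else 0 := by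
    simp only [hs, hc, Finset.card_filter]
    rw [Finset.sum_comm]
    refine Finset.sum_congr rfl fun i _ => ?_
    split_ifs with h0 <;> simp [h0]
  have hsplit : ∑ e ∈ E, ∑ i, t i e = ∑ i, d i + ∑ e ∈ F, ∑ i, t i e := by
    rw [← Finset.sum_sdiff hFE, hd, Finset.sum_comm]
  have h1 : ∑ e ∈ F, (2 + (s e).card) ≤ ∑ e ∈ F, ∑ i, t i e := Finset.sum_le_sum hNs
  have h2 : ∑ _i : ι, 1 ≤ ∑ i, (d i + if d i = 0 then (c i).card else 0) :=
    Finset.sum_le_sum fun i _ => hdc i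
  have h1' : ∑ e ∈ F, (2 + (s e).card) = 2 * F.card + ∑ e ∈ F, (s e).card := by
    simp [Finset.sum_add_distrib, mul_comm]
  have h2' : ∑ _i : ι, 1 = Fintype.card ι := by simp
  have h3 : ∑ i, (d i + if d i = 0 then (c i).card else 0)
      = ∑ i, d i + ∑ e ∈ F, (s e).card := by
    rw [Finset.sum_add_distrib, hsc]
  have hNeq : ∀ e ∈ F, 2 + (s e).card = ∑ i, t i e :=
    (Finset.sum_eq_sum_iff_of_le hNs).1 (by omega)
  have hdceq : ∀ i, 1 = d i + if d i = 0 then (c i).card else 0 := fun i =>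
    (Finset.sum_eq_sum_iff_of_le fun i _ => hdc i).1 (by omega) i (Finset.mem_univ i)
  have hd1 : ∀ i, d i ≠ 0 → d i = 1 := by
    intro i hi
    simpa [hi] using (hdceq i).symm
  have hA : ∀ i, ∀ f ∈ E, f ∉ F → 0 < t i f → t i f = 1 ∧
      ∀ g ∈ E, g ∉ F → g ≠ f → t i g = 0 := by
    intro i f hf hfF hif
    have hfm : f ∈ E \ F := Finset.mem_sdiff.2 ⟨hf, hfF⟩
    have hsum : d i = t i f + ∑ g ∈ (E \ F).erase f, t i g :=
      (Finset.add_sum_erase _ _ hfm).symm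
    have h1 := hd1 i (by omega)
    refine ⟨by omega, fun g hg hgF hgf => ?_⟩
    refine Finset.sum_eq_zero_iff.1 (show ∑ g ∈ (E \ F).erase f, t i g = 0 by omega) g ?_
    simp [hg, hgF, hgf]
  have hApar : ∀ i, ∀ f ∈ E, f ∉ F → 0 < t i f → ∀ e ∈ F, (t i e : ZMod 2) + X e f = 0 := by
    intro i f hf hfF hif e he
    obtain ⟨h1, h0⟩ := hA i f hf hfF hif
    have h := hpar i e he
    rwa [Finset.sum_eq_single f, h1, Nat.cast_one, one_mul] at h
    · intro g hg hgf
      rw [Finset.mem_sdiff] at hg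
      simp [h0 g hg.1 hg.2 hgf]
    · intro h
      exact absurd (Finset.mem_sdiff.2 ⟨hf, hfF⟩) h
  have hAcross : ∀ i, ∀ f ∈ E, f ∉ F → 0 < t i f → ∀ e ∈ F, X e f ≠ 0 → 0 < t i e := by
    intro i f hf hfF hif e he hne
    rw [Nat.pos_iff_ne_zero]
    intro h0
    have h := hApar i f hf hfF hif e he
    rw [h0, Nat.cast_zero, zero_add] at h
    exact hne h
  have hU2F : ∀ e ∈ F, (U e).card ≤ 2 := by
    intro e he
    have h1 := hUs e he
    have h2 := hNeq e he
    omega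
  have hU2 : ∀ e ∈ E, (U e).card ≤ 2 := by
    intro f hf
    by_cases hfF : f ∈ F
    · exact hU2F f hfF
    · obtain ⟨e, he, hne⟩ := hsep f hf hfF
      refine (Finset.card_le_card fun i hi => ?_).trans (hU2F e he)
      simp only [hU, Finset.mem_filter, Finset.mem_univ, true_and] at hi ⊢
      exact hAcross i f hf hfF hi e he hne
  have huniq : ∀ e ∈ E, ∀ j k, j ≠ i → k ≠ i → 0 < t i e → 0 < t j e → 0 < t k e → k = j := by
    intro e he j k hj hk hie hje hke
    by_contra hkj
    have : 2 < (U e).card := Finset.two_lt_card.2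
      ⟨i, by simp [hU, hie], j, by simp [hU, hje], k, by simp [hU, hke], hj.symm, hk.symm,
        fun h => hkj h.symm⟩
    have := hU2 e he
    omega
  by_cases h0 : d i = 0
  · obtain ⟨j, hji, e, he, hie, hje⟩ := hshare i
    refine ⟨j, ⟨hji, e, he, hie, hje⟩, ?_⟩
    rintro k ⟨hki, e', he', hie', hke'⟩
    have hmem : ∀ g ∈ E, 0 < t i g → ∀ l ≠ i, 0 < t l g → g ∈ c i := by
      intro g hg hig l hl hlg
      have hgF : g ∈ F := by
        by_contra hF
        have := hd0 i h0 g hg hF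
        omega
      simp only [hc, Finset.mem_filter]
      exact ⟨hgF, hig, l, hl, hlg⟩
    have hc1 : (c i).card ≤ 1 := by
      have := hdceq i
      rw [if_pos h0] at this
      omega
    obtain rfl : e' = e := Finset.card_le_one.1 hc1 _ (hmem e' he' hie' k hki hke') _
      (hmem e he hie j hji hje)
    exact huniq e' he j k hji hki hie hje hke'
  · obtain ⟨f, hfm, hif⟩ := Finset.exists_ne_zero_of_sum_ne_zero h0
    obtain ⟨hf, hfF⟩ := Finset.mem_sdiff.1 hfm
    replace hif : 0 < t i f := Nat.pos_of_ne_zero hif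
    obtain ⟨hif1, hif0⟩ := hA i f hf hfF hif
    obtain ⟨j, hji, hjf⟩ : ∃ j ≠ i, 0 < t j f := by
      by_contra! hcon
      have := htwo f hf
      rw [Finset.sum_eq_single i (fun j _ hj => by simpa using hcon j hj) (by simp)] at this
      omega
    refine ⟨j, ⟨hji, f, hf, hif, hjf⟩, ?_⟩
    rintro k ⟨hki, e, he, hie, hke⟩
    by_cases heF : e ∈ F
    · by_cases hXe : X e f = 0
      · exfalso
        have hi := hApar i f hf hfF hif e heF
        rw [hXe, add_zero, ZMod.natCast_eq_zero_iff_even] at hi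
        have hN : t i e + t k e ≤ ∑ l, t l e := by
          rw [← Finset.sum_pair (f := fun l => t l e) hki.symm]
          exact Finset.sum_le_sum_of_subset (Finset.subset_univ _)
        have hNe := hNeq e heF
        have hi2 : 2 ≤ t i e := by obtain ⟨m, hm⟩ := hi; omega
        have hsk : s e ⊆ {k} := by
          intro l hl
          have hlU := hsU e hl
          simp only [hs, hU, Finset.mem_filter, Finset.mem_univ, true_and] at hl hlU
          have hli : l ≠ i := fun h => h0 (h ▸ hl.1)
          exact Finset.mem_singleton.2 (huniq e he k l hki hli hie hke hlU)
        have hs1 : (s e).card ≤ 1 := by simpa using Finset.card_le_card hsk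
        have hks : k ∈ s e := by
          obtain ⟨l, hl⟩ := Finset.card_pos.1 (show 0 < (s e).card by omega)
          obtain rfl := Finset.mem_singleton.1 (hsk hl)
          exact hl
        simp only [hs, Finset.mem_filter, Finset.mem_univ, true_and] at hks
        obtain ⟨m, hm⟩ := heven k hks.1 e heF
        omega
      · exact huniq e he j k hji hki hie (hAcross j f hf hfF hjf e heF hXe) hke
    · obtain rfl : e = f := by
        by_contra hne
        have := hif0 e he heF hne
        omega
      exact huniq e he j k hji hki hie hjf hke

@[simp]
theorem edgeList_singleton (x : ℕ) : edgeList [x] = [] := rfl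

@[simp]
theorem edgeList_cons_cons (x y : ℕ) (l : List ℕ) :
    edgeList (x :: y :: l) = s(x, y) :: edgeList (y :: l) := rfl

theorem length_edgeList (w : List ℕ) : (edgeList w).length = w.length - 1 := by
  simp [edgeList]

theorem mem_of_mem_edgeList {w : List ℕ} {u v : ℕ} (h : s(u, v) ∈ edgeList w) :
    u ∈ w ∧ v ∈ w := by
  obtain ⟨⟨x, y⟩, hp, hxy⟩ := List.mem_map.1 h
  obtain ⟨hx, hy⟩ := List.of_mem_zip hp
  replace hy := List.mem_of_mem_tail hy
  rcases Sym2.eq_iff.1 hxy with ⟨rfl, rfl⟩ | ⟨rfl, rfl⟩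
  · exact ⟨hx, hy⟩
  · exact ⟨hy, hx⟩

theorem sum_coboundary_edgeList (χ : ℕ → ZMod 2) (x : ℕ) (l : List ℕ) :
    ((edgeList (x :: l)).map (coboundary χ)).sum =
      χ x + χ ((x :: l).getLast (List.cons_ne_nil x l)) := by
  induction l generalizing x with
  | nil => simp [CharTwo.add_self_eq_zero]
  | cons y l ih =>
    rw [edgeList_cons_cons, List.map_cons, List.sum_cons, ih y, coboundary_mk,
      List.getLast_cons (List.cons_ne_nil y l)]
    rw [add_assoc, CharTwo.add_cancel_left]

theorem exists_edge_leaving (S : Finset ℕ) (x : ℕ) (l : List ℕ) (hx : x ∈ S) {v : ℕ}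
    (hv : v ∈ x :: l) (hvS : v ∉ S) :
    ∃ u ∈ S, ∃ y ∉ S, s(u, y) ∈ edgeList (x :: l) := by
  induction l generalizing x with
  | nil =>
    obtain rfl := List.mem_singleton.1 hv
    exact absurd hx hvS
  | cons y l ih =>
    by_cases hy : y ∈ S
    · have hv' : v ∈ y :: l := by
        rcases List.mem_cons.1 hv with rfl | h
        · exact absurd hx hvS
        · exact h
      obtain ⟨u, hu, z, hz, h⟩ := ih y hy hv'
      exact ⟨u, hu, z, hz, by simp [h]⟩
    · exact ⟨x, hx, y, hy, by simp⟩

theorem IsClosedWordAtOne.exists_eq_cons {w : List ℕ} (h : IsClosedWordAtOne w) :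
    ∃ l, w = 1 :: l := by
  obtain ⟨-, h1, -⟩ := h
  cases w with
  | nil => simp at h1
  | cons x l => exact ⟨l, by simpa using h1⟩

theorem IsClosedWordAtOne.sum_coboundary {w : List ℕ} (h : IsClosedWordAtOne w)
    (χ : ℕ → ZMod 2) : ((edgeList w).map (coboundary χ)).sum = 0 := by
  obtain ⟨l, rfl⟩ := h.exists_eq_cons
  have hlast := h.2.2.1
  rw [List.getLast?_eq_getLast_of_ne_nil (List.cons_ne_nil 1 l), Option.some_inj] at hlast
  rw [sum_coboundary_edgeList, hlast, CharTwo.add_self_eq_zero]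

theorem mem_sentEdgeFinset {a : List (List ℕ)} {e : Sym2 ℕ} :
    e ∈ sentEdgeFinset a ↔ ∃ w ∈ a, e ∈ edgeList w := by
  simp [sentEdgeFinset, sentEdgeList]

theorem mem_sentSupp {a : List (List ℕ)} {v : ℕ} : v ∈ sentSupp a ↔ ∃ w ∈ a, v ∈ w := by
  simp [sentSupp]

theorem sentTrav_eq_sum (a : List (List ℕ)) (e : Sym2 ℕ) :
    sentTrav a e = ∑ i : Fin a.length, trav (a.get i) e := by
  rw [sentTrav, sentEdgeList, List.count_flatten, List.map_map]
  exact (Fin.sum_univ_fun_getElem a fun w => trav w e).symm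

theorem sum_trav {M : Type*} [CommSemiring M] {w : List ℕ} {E : Finset (Sym2 ℕ)}
    (hE : ∀ e ∈ edgeList w, e ∈ E) (g : Sym2 ℕ → M) :
    ∑ e ∈ E, (trav w e : M) * g e = ((edgeList w).map g).sum := by
  rw [Finset.sum_list_map_count]
  simp only [nsmul_eq_mul]
  refine (Finset.sum_subset (fun e he => hE e (List.mem_toFinset.1 he)) fun e _ he => ?_).symm
  rw [List.mem_toFinset] at he
  rw [trav, List.count_eq_zero_of_not_mem he, Nat.cast_zero, zero_mul]

theorem edgeFinset_inter_nonempty {a : List (List ℕ)} {w w' : List ℕ} (hw : w ∈ a) :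
    (edgeFinset w ∩ edgeFinset w').Nonempty ↔
      ∃ e ∈ sentEdgeFinset a, 0 < trav w e ∧ 0 < trav w' e := by
  simp only [Finset.Nonempty, Finset.mem_inter, edgeFinset, List.mem_toFinset, trav,
    List.count_pos_iff]
  exact ⟨fun ⟨e, h⟩ => ⟨e, mem_sentEdgeFinset.2 ⟨w, hw, h.1⟩, h⟩, fun ⟨e, _, h⟩ => ⟨e, h⟩⟩

/-- **Unique partner in a CLT sentence.** If `a = (w₁, …, wₙ)` is a CLT sentence whose words
contain no self-edge, then for each index `i` there is a unique index `j ≠ i` such that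
`w_i` and `w_j` share an edge. -/
theorem CLT_sentence_unique_partner (a : List (List ℕ)) (h : IsCLTSentence a)
    (hself : ∀ w ∈ a, ∀ e ∈ edgeFinset w, ¬ e.IsDiag) :
    ∀ i : Fin a.length, ∃! j : Fin a.length, j ≠ i ∧
      (edgeFinset (a.get i) ∩ edgeFinset (a.get j)).Nonempty := by
  obtain ⟨⟨hne, hclosed, htwo, hshare⟩, hwt⟩ := h
  have hmem : ∀ i : Fin a.length, a.get i ∈ a := fun i => a.get_mem i
  have hEi : ∀ i : Fin a.length, ∀ e ∈ edgeList (a.get i), e ∈ sentEdgeFinset a :=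
    fun i e he => mem_sentEdgeFinset.2 ⟨_, hmem i, he⟩
  obtain ⟨F, hFE, χ, hFc, hcut, hsep⟩ :=
    exists_spanningTree_cuts (sentSupp a) (sentEdgeFinset a) 1
      (by
        obtain ⟨w, hw⟩ := List.exists_mem_of_ne_nil a hne
        obtain ⟨l, rfl⟩ := (hclosed w hw).exists_eq_cons
        exact mem_sentSupp.2 ⟨_, hw, by simp⟩)
      (by
        intro S hS h1
        obtain ⟨v, hv, hvS⟩ := Finset.exists_of_ssubset hS
        obtain ⟨w, hw, hvw⟩ := mem_sentSupp.1 hv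
        obtain ⟨l, rfl⟩ := (hclosed w hw).exists_eq_cons
        obtain ⟨u, hu, y, hy, he⟩ := exists_edge_leaving S 1 l h1 hvw hvS
        exact ⟨u, hu, y, mem_sentSupp.2 ⟨_, hw, (mem_of_mem_edgeList he).2⟩, hy,
          mem_sentEdgeFinset.2 ⟨_, hw, he⟩⟩)
  have hcount : 2 * F.card + Fintype.card (Fin a.length) =
      ∑ e ∈ sentEdgeFinset a, ∑ i : Fin a.length, trav (a.get i) e := by
    have hlen : ∀ i : Fin a.length, ∑ e ∈ sentEdgeFinset a, trav (a.get i) e + 1 =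
        (a.get i).length := by
      intro i
      have hs := sum_trav (hEi i) (fun _ => (1 : ℕ))
      have hpos : 0 < (a.get i).length := List.length_pos_of_ne_nil (hclosed _ (hmem i)).1
      simp only [Nat.cast_id, mul_one, List.map_const', List.sum_replicate, smul_eq_mul,
        length_edgeList] at hs
      omega
    rw [Finset.sum_comm]
    have hq : ((sentSupp a).card : ℚ) = F.card + 1 := by exact_mod_cast hFc.symm
    rw [hq, ← Finset.sum_div, Finset.sum_sub_distrib] at hwt
    have hl : ∑ i : Fin a.length, ((a.get i).length : ℚ) =
        ∑ i : Fin a.length, ∑ e ∈ sentEdgeFinset a, (trav (a.get i) e : ℚ) + a.length := by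
      simp only [← hlen, Nat.cast_add, Nat.cast_sum, Nat.cast_one, Finset.sum_add_distrib]
      simp
    rw [hl] at hwt
    simp only [Finset.sum_const, Finset.card_univ, Fintype.card_fin, nsmul_eq_mul] at hwt
    rw [Fintype.card_fin, ← Nat.cast_inj (R := ℚ)]
    push_cast
    linarith
  intro i
  simp only [edgeFinset_inter_nonempty (hmem _)] at hshare ⊢
  refine existsUnique_partner (sentEdgeFinset a) F hFE (fun i e => trav (a.get i) e)
    (fun e => coboundary (χ e)) ?_ hcount hshare hcut ?_ ?_ i
  · intro e he
    rw [← sentTrav_eq_sum]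
    exact htwo e he
  · intro i e _
    rw [sum_trav (hEi i)]
    exact (hclosed _ (hmem i)).sum_coboundary _
  · intro f hf _
    obtain ⟨w, hw, hfw⟩ := mem_sentEdgeFinset.1 hf
    have hdiag := hself w hw f (List.mem_toFinset.2 hfw)
    induction f with
    | _ u v =>
      obtain ⟨hu, hv⟩ := mem_of_mem_edgeList hfw
      obtain ⟨e, he, hne⟩ := hsep u (mem_sentSupp.2 ⟨w, hw, hu⟩) v (mem_sentSupp.2 ⟨w, hw, hv⟩)
        (fun h => hdiag (by simpa using h))
      refine ⟨e, he, fun h0 => hne ?_⟩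
      rwa [coboundary_mk, CharTwo.add_eq_zero] at h0
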